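/- Fix c > 0 and n ≥ 1. Suppose that for every convex function V : ℝⁿ → ℝ whose Fenchel-Legendre transform V* is finite everywhere, the inequality H(η) + H(η*) ≤ −n·log(c·e²) + 𝒯(ν, ν*) holds, where η, η* are the probability measures proportional to e^{-V}, e^{-V*} and ν, ν* their moment measures. Then for every proper convex lower semicontinuous f : ℝⁿ → ℝ ∪ {+∞} with ∫ e^{-f} dx > 0 and ∫ e^{-f*} dx > 0, one has ∫ e^{-f(x)} dx · ∫ e^{-f*(x)} dx ≥ cⁿ. -/

import Mathlib

open MeasureTheory Real Set
open scoped ENNReal InnerProductSpace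

noncomputable section

variable {E : Type*} [NormedAddCommGroup E] [InnerProductSpace ℝ E]

/-- `exp (-t)` for an extended-real `t`, with the convention that it is `0` at `⊤`
(proper functions never take the value `⊥`; we also set the value at `⊥` to `0`). -/
def expNeg (t : EReal) : ℝ := if t = ⊤ then 0 else if t = ⊥ then 0 else Real.exp (-t.toReal)

/-- Convexity for extended-real-valued functions. -/
def ConvexEReal (f : E → EReal) : Prop :=
  ∀ x y : E, ∀ a b : ℝ, 0 ≤ a → 0 ≤ b → a + b = 1 →
    f (a • x + b • y) ≤ (a : EReal) * f x + (b : EReal) * f y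

/-- The class `𝓕` of proper convex lower semicontinuous functions `E → ℝ ∪ {+∞}`. -/
def IsProperConvexLSC (f : E → EReal) : Prop :=
  ConvexEReal f ∧ LowerSemicontinuous f ∧ (∀ x, f x ≠ ⊥) ∧ (∃ x, f x ≠ ⊤)

/-- Fenchel-Legendre transform of an extended-real-valued function. -/
def fenchel (f : E → EReal) (y : E) : EReal := ⨆ x : E, (⟪x, y⟫_ℝ : EReal) - f x

/-- Fenchel-Legendre transform of a real-valued function. -/
def fenchelR (f : E → ℝ) (y : E) : EReal := ⨆ x : E, ((⟪x, y⟫_ℝ - f x : ℝ) : EReal)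

/-- positive part of an extended real, as `ℝ≥0∞`. -/
def ERealPos (t : EReal) : ℝ≥0∞ := if t = ⊤ then ⊤ else ENNReal.ofReal t.toReal

/-- Integral of an extended-real-valued function, with value in `EReal`. -/
def eintegral {α : Type*} [MeasurableSpace α] (μ : Measure α) (g : α → EReal) : EReal :=
  ((∫⁻ x, ERealPos (g x) ∂μ : ℝ≥0∞) : EReal) - ((∫⁻ x, ERealPos (-(g x)) ∂μ : ℝ≥0∞) : EReal)

variable [MeasurableSpace E]

/-- The maximal correlation transport cost `𝒯(μ₁, μ₂)`. -/
def mcCost (μ₁ μ₂ : Measure E) : EReal :=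
  ⨅ f : {f : E → EReal // IsProperConvexLSC f},
    eintegral μ₁ f.1 + eintegral μ₂ (fenchel f.1)

/-- The probability measure proportional to `e^{-W}` (with respect to Lebesgue measure). -/
def probOf {n : ℕ} (W : EuclideanSpace ℝ (Fin n) → ℝ) : Measure (EuclideanSpace ℝ (Fin n)) :=
  (∫⁻ x, ENNReal.ofReal (Real.exp (-(W x))))⁻¹ •
    volume.withDensity (fun x => ENNReal.ofReal (Real.exp (-(W x))))

/-- Relative entropy with respect to the Lebesgue measure. -/
def relEnt {n : ℕ} (μ : Measure (EuclideanSpace ℝ (Fin n))) : ℝ :=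
  ∫ x, Real.log ((μ.rnDeriv volume x).toReal) ∂μ

section GradientOfConvex

variable {F : Type*} [NormedAddCommGroup F] [InnerProductSpace ℝ F] [CompleteSpace F]

lemma hasDerivAt_comp_smul_one {V : F → ℝ} {x : F}
    (hx : DifferentiableAt ℝ V x) :
    HasDerivAt (fun t : ℝ => V (t • x)) ⟪gradient V x, x⟫_ℝ 1 := by
  have h1 : HasDerivAt (fun t : ℝ => t • x) x 1 := by
    simpa using (hasDerivAt_id (1 : ℝ)).smul_const x
  have h2 : HasFDerivAt V (fderiv ℝ V x) ((1 : ℝ) • x) := by simpa using hx.hasFDerivAt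
  simpa [gradient, InnerProductSpace.toDual_symm_apply, Function.comp_def]
    using h2.comp_hasDerivAt (1 : ℝ) h1

lemma ConvexOn.add_inner_gradient_le {V : F → ℝ} (hV : ConvexOn ℝ univ V)
    {x : F} (hx : DifferentiableAt ℝ V x) (z : F) :
    V x + ⟪gradient V x, z - x⟫_ℝ ≤ V z := by
  have h1 : HasDerivAt (fun t : ℝ => x + t • (z - x)) (z - x) 0 := by
    simpa using ((hasDerivAt_id (0 : ℝ)).smul_const (z - x)).const_add x
  have h2 : HasFDerivAt V (fderiv ℝ V x) (x + (0 : ℝ) • (z - x)) := by simpa using hx.hasFDerivAt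
  have h3 : HasDerivAt (fun t : ℝ => V (x + t • (z - x))) ⟪gradient V x, z - x⟫_ℝ 0 := by
    simpa [gradient, InnerProductSpace.toDual_symm_apply, Function.comp_def]
      using h2.comp_hasDerivAt (0 : ℝ) h1
  have h4 : ConvexOn ℝ univ (fun t : ℝ => V (x + t • (z - x))) := by
    refine ⟨convex_univ, fun s _ t _ a b ha hb hab => ?_⟩
    have := hV.2 (mem_univ (x + s • (z - x))) (mem_univ (x + t • (z - x))) ha hb hab
    refine le_trans (le_of_eq ?_) this
    obtain rfl : a = 1 - b := by linarith
    refine congrArg V ?_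
    simp only [smul_eq_mul]
    module
  have h5 := h4.deriv_le_slope (mem_univ 0) (mem_univ 1) one_pos h3.differentiableAt
  rw [h3.deriv] at h5
  simp only [slope, sub_zero, inv_one, one_smul, zero_smul, add_zero, add_sub_cancel,
    vsub_eq_sub] at h5
  linarith

end GradientOfConvex

section LogConcaveIntegrals

open Filter Topology

variable {F : Type*} [NormedAddCommGroup F] [InnerProductSpace ℝ F] [FiniteDimensional ℝ F]
  [MeasurableSpace F] [BorelSpace F] (μ : Measure F) [μ.IsAddHaarMeasure]

lemma integrable_exp_neg_mul_norm {a : ℝ} (ha : 0 < a) :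
    Integrable (fun x : F => Real.exp (-(a * ‖x‖))) μ := by
  set d := Module.finrank ℝ F + 1 with hd
  have h1 : Integrable (fun x : F => (1 + ‖x‖) ^ (-(d : ℝ))) μ :=
    integrable_one_add_norm (by rw [hd]; push_cast; linarith)
  refine (h1.const_mul (Real.exp a * (d.factorial / a ^ d))).mono' (by fun_prop)
    (ae_of_all _ fun x => ?_)
  have hx : (0 : ℝ) < 1 + ‖x‖ := by positivity
  have h2 := Real.pow_div_factorial_le_exp (a * (1 + ‖x‖)) (by positivity) d
  rw [Real.norm_of_nonneg (Real.exp_pos _).le, Real.rpow_neg hx.le, Real.rpow_natCast]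
  have h3 : Real.exp (-(a * ‖x‖)) = Real.exp a * (Real.exp (a * (1 + ‖x‖)))⁻¹ := by
    rw [← Real.exp_neg, ← Real.exp_add]; ring_nf
  rw [h3, mul_assoc]
  gcongr
  rw [mul_pow] at h2
  have h4 : (d.factorial / a ^ d : ℝ) * ((1 + ‖x‖) ^ d)⁻¹
      = (a ^ d * (1 + ‖x‖) ^ d / d.factorial)⁻¹ := by
    rw [inv_div]; field_simp
  rw [h4]
  gcongr

lemma integrable_exp_neg_of_linear_le {V : F → ℝ} (hV : Continuous V) {a b : ℝ} (ha : 0 < a)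
    (hb : ∀ x, a * ‖x‖ - b ≤ V x) : Integrable (fun x => Real.exp (-V x)) μ := by
  refine ((integrable_exp_neg_mul_norm μ ha).const_mul (Real.exp b)).mono' (by fun_prop)
    (ae_of_all _ fun x => ?_)
  rw [Real.norm_of_nonneg (Real.exp_pos _).le, ← Real.exp_add]
  exact Real.exp_le_exp.2 (by linarith [hb x])

lemma integrable_mul_exp_neg_of_linear_le {V : F → ℝ} (hV : Continuous V) {a b : ℝ} (ha : 0 < a)
    (hb : ∀ x, a * ‖x‖ - b ≤ V x) : Integrable (fun x => V x * Real.exp (-V x)) μ := by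
  have h1 : Integrable (fun x => Real.exp (-(V x / 2))) μ :=
    integrable_exp_neg_of_linear_le μ (V := fun x => V x / 2) (by fun_prop)
      (a := a / 2) (b := b / 2) (by positivity) (fun x => by linarith [hb x])
  refine (h1.const_mul (2 * Real.exp |b|)).mono' (by fun_prop) (ae_of_all _ fun x => ?_)
  rw [norm_mul, Real.norm_of_nonneg (Real.exp_pos _).le, Real.norm_eq_abs]
  have h2 : |V x| ≤ V x + 2 * |b| := by
    have : 0 ≤ a * ‖x‖ := by positivity
    rw [abs_le]; constructor <;> linarith [hb x, le_abs_self b, abs_nonneg b]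
  have h3 := Real.add_one_le_exp (V x / 2 + |b|)
  have h4 : Real.exp (-(V x / 2)) = Real.exp (V x / 2) * Real.exp (-V x) := by
    rw [← Real.exp_add]; ring_nf
  rw [h4, ← mul_assoc]
  gcongr
  rw [Real.exp_add] at h3
  linarith

lemma ConvexOn.ae_differentiableAt {V : F → ℝ} (hV : ConvexOn ℝ univ V) :
    ∀ᵐ x ∂μ, DifferentiableAt ℝ V x := by
  rw [ae_iff]
  refine measure_null_of_locally_null _ fun x _ => ?_
  obtain ⟨K, t, ht, hK⟩ := hV.locallyLipschitz x
  obtain ⟨u, hut, hu, hxu⟩ := mem_nhds_iff.1 ht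
  refine ⟨{y | ¬ DifferentiableAt ℝ V y} ∩ u,
    inter_mem self_mem_nhdsWithin (mem_nhdsWithin_of_mem_nhds (hu.mem_nhds hxu)), ?_⟩
  have h := (hK.mono hut).ae_differentiableWithinAt (μ := μ) hu.measurableSet
  rw [ae_restrict_iff' hu.measurableSet, ae_iff] at h
  refine measure_mono_null ?_ h
  rintro y ⟨hy, hyu⟩
  rw [Set.mem_ofPred_eq, Classical.not_imp]
  exact ⟨hyu, fun hd => hy (hd.differentiableAt (hu.mem_nhds hyu))⟩

lemma measurable_gradient (V : F → ℝ) : Measurable (gradient V) :=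
  (InnerProductSpace.toDual ℝ F).symm.continuous.measurable.comp (measurable_fderiv ℝ V)

/-- The radial derivative of a convex potential `V` is integrable against `exp (-V)`, with
integral at most `dim * ∫ exp (-V)`. -/
lemma ConvexOn.integrable_inner_gradient_mul_exp_neg {V : F → ℝ} (hV : ConvexOn ℝ univ V)
    (h1 : Integrable (fun x => Real.exp (-V x)) μ)
    (h2 : Integrable (fun x => V x * Real.exp (-V x)) μ) :
    Integrable (fun x => ⟪gradient V x, x⟫_ℝ * Real.exp (-V x)) μ ∧
      ∫ x, ⟪gradient V x, x⟫_ℝ * Real.exp (-V x) ∂μ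
        ≤ Module.finrank ℝ F * ∫ x, Real.exp (-V x) ∂μ := by
  set d := Module.finrank ℝ F
  set Z := ∫ x, Real.exp (-V x) ∂μ with hZ
  have hVc : Continuous V := hV.locallyLipschitz.continuous
  set J : F → ℝ := fun x => V x * Real.exp (-V x) - V 0 * Real.exp (-V x) with hJ
  have hJi : Integrable J μ := h2.sub (h1.const_mul _)
  set G : ℝ → F → ℝ := fun t x =>
    (Real.exp (-V (t • x)) - Real.exp (-V x)) * (1 - t)⁻¹ - J x with hG
  set H : F → ℝ := fun x => ⟪gradient V x, x⟫_ℝ * Real.exp (-V x) - J x with hH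
  have hI : ∀ᶠ t : ℝ in 𝓝[<] 1, t ∈ Ioo (0 : ℝ) 1 := Ioo_mem_nhdsLT one_pos
  have hle : (𝓝[<] (1 : ℝ)) ≤ 𝓝[≠] 1 := nhdsWithin_mono _ fun t ht => ne_of_lt ht
  have hGnn : ∀ t ∈ Ioo (0 : ℝ) 1, ∀ x, 0 ≤ G t x := by
    intro t ht x
    have hc : V (t • x) ≤ t * V x + (1 - t) * V 0 := by
      have := hV.2 (mem_univ x) (mem_univ (0 : F)) ht.1.le (sub_nonneg.2 ht.2.le) (by ring)
      simpa using this
    have he : Real.exp (-V x) * (V x - V (t • x) + 1) ≤ Real.exp (-V (t • x)) := by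
      have : Real.exp (-V (t • x)) = Real.exp (-V x) * Real.exp (V x - V (t • x)) := by
        rw [← Real.exp_add]; ring_nf
      rw [this]; gcongr; exact Real.add_one_le_exp _
    have ht' : 0 < 1 - t := sub_pos.2 ht.2
    simp only [hG, hJ, sub_nonneg]
    rw [← div_eq_mul_inv, le_div_iff₀ ht']
    have := Real.exp_pos (-V x)
    nlinarith
  have hGint : ∀ t ∈ Ioo (0 : ℝ) 1, Integrable (G t) μ := by
    intro t ht
    refine Integrable.sub (Integrable.mul_const (Integrable.sub ?_ h1) _) hJi
    exact h1.comp_smul (R := t) ht.1.ne'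
  have hGval : ∀ t ∈ Ioo (0 : ℝ) 1, ∫ x, G t x ∂μ
      = -slope (fun t : ℝ => (t ^ d)⁻¹) 1 t * Z - ∫ x, J x ∂μ := by
    intro t ht
    have hi : Integrable (fun x => Real.exp (-V (t • x))) μ := h1.comp_smul (R := t) ht.1.ne'
    simp only [hG]
    have hd : Integrable (fun x => Real.exp (-V (t • x)) - Real.exp (-V x)) μ := hi.sub h1
    rw [integral_sub (hd.mul_const _) hJi, integral_mul_const, integral_sub hi h1,
      Measure.integral_comp_smul μ (fun x => Real.exp (-V x)) t,
      abs_of_pos (by have := ht.1; positivity)]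
    congr 1
    simp only [slope, smul_eq_mul, vsub_eq_sub, ← hZ, one_pow, inv_one]
    have : (t - 1)⁻¹ = -(1 - t)⁻¹ := by rw [← inv_neg]; ring_nf
    rw [this]; ring
  have hlim : Tendsto (fun t => ∫ x, G t x ∂μ) (𝓝[<] 1) (𝓝 (d * Z - ∫ x, J x ∂μ)) := by
    have hd : HasDerivAt (fun t : ℝ => (t ^ d)⁻¹) (-d : ℝ) 1 := by
      simpa using (hasDerivAt_pow d (1 : ℝ)).fun_inv (by simp)
    have := (((hasDerivAt_iff_tendsto_slope.1 hd).mono_left hle).neg.mul_const Z).sub_const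
      (∫ x, J x ∂μ)
    rw [neg_neg] at this
    refine this.congr' ?_
    filter_upwards [hI] with t ht
    rw [hGval t ht]
  have hpt : ∀ᵐ x ∂μ, Tendsto (fun t => G t x) (𝓝[<] 1) (𝓝 (H x)) := by
    filter_upwards [hV.ae_differentiableAt μ] with x hx
    have hd := (hasDerivAt_comp_smul_one hx).fun_neg.exp
    have := (((hasDerivAt_iff_tendsto_slope.1 hd).mono_left hle).neg).sub_const (J x)
    convert this using 2
    · rename_i t
      simp only [hG, slope, smul_eq_mul, vsub_eq_sub, one_smul]
      have : (t - 1)⁻¹ = -(1 - t)⁻¹ := by rw [← inv_neg]; ring_nf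
      rw [this]; ring
    · simp only [hH, one_smul]; ring
  have hHnn : 0 ≤ᵐ[μ] H := by
    filter_upwards [hpt] with x hx
    exact ge_of_tendsto hx (hI.mono fun t ht => hGnn t ht x)
  have hlim0 : 0 ≤ d * Z - ∫ x, J x ∂μ :=
    ge_of_tendsto hlim (hI.mono fun t ht => integral_nonneg (hGnn t ht))
  have hfatou : ∫⁻ x, ENNReal.ofReal (H x) ∂μ ≤ ENNReal.ofReal (d * Z - ∫ x, J x ∂μ) := by
    have hf := lintegral_liminf_le (μ := μ) (f := fun t x => ENNReal.ofReal (G t x))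
      (u := 𝓝[<] (1 : ℝ)) (fun t => by
        apply Measurable.ennreal_ofReal
        apply Continuous.measurable
        simp only [hG, hJ]; fun_prop)
    refine le_trans (le_of_eq (lintegral_congr_ae ?_)) (hf.trans (le_of_eq ?_))
    · filter_upwards [hpt] with x hx
      exact ((ENNReal.tendsto_ofReal hx).liminf_eq).symm
    · refine Tendsto.liminf_eq ((ENNReal.tendsto_ofReal hlim).congr' ?_)
      filter_upwards [hI] with t ht
      exact ofReal_integral_eq_lintegral_ofReal (hGint t ht) (ae_of_all _ (hGnn t ht))
  have hHm : AEStronglyMeasurable H μ := by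
    refine (Measurable.sub (Measurable.mul ((measurable_gradient V).inner measurable_id) ?_)
      ?_).aestronglyMeasurable
    · fun_prop
    · apply Continuous.measurable; simp only [hJ]; fun_prop
  have hHi : Integrable H μ := by
    refine ⟨hHm, ?_⟩
    rw [hasFiniteIntegral_iff_ofReal hHnn]
    exact hfatou.trans_lt ENNReal.ofReal_lt_top
  have hHle : ∫ x, H x ∂μ ≤ d * Z - ∫ x, J x ∂μ := by
    rw [integral_eq_lintegral_of_nonneg_ae hHnn hHm]
    exact ENNReal.toReal_le_of_le_ofReal hlim0 hfatou
  have hsum : (fun x => ⟪gradient V x, x⟫_ℝ * Real.exp (-V x)) = fun x => H x + J x := by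
    ext x; simp [hH]
  rw [hsum]
  refine ⟨hHi.add hJi, ?_⟩
  rw [integral_add hHi hJi]
  linarith

end LogConcaveIntegrals

section ERealIntegral

lemma ERealPos_coe (r : ℝ) : ERealPos (r : EReal) = ENNReal.ofReal r := by
  simp [ERealPos]

lemma ERealPos_mono : Monotone ERealPos := by
  intro s t h
  induction t with
  | top => simp [ERealPos]
  | bot => rw [le_bot_iff.1 h]
  | coe t =>
    induction s with
    | top => exact absurd (top_le_iff.1 h) (EReal.coe_ne_top t)
    | bot => simp [ERealPos]
    | coe s =>
      rw [ERealPos_coe, ERealPos_coe]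
      exact ENNReal.ofReal_le_ofReal (EReal.coe_le_coe_iff.1 h)

lemma measurable_ERealPos : Measurable ERealPos := ERealPos_mono.measurable

variable {α β : Type*} [MeasurableSpace α] [MeasurableSpace β]

lemma eintegral_mono_ae {μ : Measure α} {g h : α → EReal} (hgh : ∀ᵐ x ∂μ, g x ≤ h x) :
    eintegral μ g ≤ eintegral μ h := by
  refine EReal.sub_le_sub ?_ ?_
  · exact EReal.coe_ennreal_le_coe_ennreal_iff.2
      (lintegral_mono_ae (hgh.mono fun x hx => ERealPos_mono hx))
  · exact EReal.coe_ennreal_le_coe_ennreal_iff.2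
      (lintegral_mono_ae (hgh.mono fun x hx => ERealPos_mono (EReal.neg_le_neg_iff.2 hx)))

lemma eintegral_map {μ : Measure α} {φ : α → β} (hφ : Measurable φ) {g : β → EReal}
    (hg : Measurable g) : eintegral (μ.map φ) g = eintegral μ (g ∘ φ) := by
  rw [eintegral, lintegral_map (f := fun x => ERealPos (g x)) (measurable_ERealPos.comp hg) hφ,
    lintegral_map (f := fun x => ERealPos (-g x))
      (measurable_ERealPos.comp (measurable_neg.comp hg)) hφ]
  rfl

lemma eintegral_coe {μ : Measure α} {g : α → ℝ} (hg : Integrable g μ) :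
    eintegral μ (fun x => (g x : EReal)) = ((∫ x, g x ∂μ : ℝ) : EReal) := by
  have h1 : ∫⁻ x, ENNReal.ofReal (g x) ∂μ ≠ ⊤ := hg.lintegral_lt_top.ne
  have h2 : ∫⁻ x, ENNReal.ofReal (-g x) ∂μ ≠ ⊤ := hg.neg.lintegral_lt_top.ne
  rw [eintegral, integral_eq_lintegral_pos_part_sub_lintegral_neg_part hg, EReal.coe_sub,
    EReal.coe_ennreal_toReal h1, EReal.coe_ennreal_toReal h2]
  simp only [← EReal.coe_neg, ERealPos_coe]

end ERealIntegral

section FenchelOfReal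

variable {F : Type*} [NormedAddCommGroup F] [InnerProductSpace ℝ F]

lemma lowerSemicontinuous_fenchelR (V : F → ℝ) : LowerSemicontinuous (fenchelR V) := by
  refine lowerSemicontinuous_iSup fun x => Continuous.lowerSemicontinuous ?_
  exact continuous_coe_real_ereal.comp (by fun_prop)

lemma fenchel_coe (V : F → ℝ) : fenchel (fun x => (V x : EReal)) = fenchelR V := by
  ext y
  simp [fenchel, fenchelR]

variable {V W : F → ℝ}

lemma inner_sub_le_of_eq_fenchelR (hW : ∀ y, (W y : EReal) = fenchelR V y)
    (x y : F) : ⟪x, y⟫_ℝ - V x ≤ W y := by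
  rw [← EReal.coe_le_coe_iff, hW y]
  exact le_iSup (fun x : F => ((⟪x, y⟫_ℝ - V x : ℝ) : EReal)) x

lemma le_of_eq_fenchelR (hW : ∀ y, (W y : EReal) = fenchelR V y)
    {y : F} {M : ℝ} (h : ∀ x, ⟪x, y⟫_ℝ - V x ≤ M) : W y ≤ M := by
  rw [← EReal.coe_le_coe_iff, hW y]
  exact iSup_le fun x => EReal.coe_le_coe_iff.2 (h x)

lemma convexOn_of_eq_fenchelR (hW : ∀ y, (W y : EReal) = fenchelR V y) :
    ConvexOn ℝ univ W := by
  refine ⟨convex_univ, fun y _ z _ a b ha hb hab => le_of_eq_fenchelR hW fun x => ?_⟩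
  have h1 := mul_le_mul_of_nonneg_left (inner_sub_le_of_eq_fenchelR hW x y) ha
  have h2 := mul_le_mul_of_nonneg_left (inner_sub_le_of_eq_fenchelR hW x z) hb
  rw [inner_add_right, inner_smul_right, inner_smul_right]
  simp only [smul_eq_mul]
  obtain rfl : a = 1 - b := by linarith
  linarith

end FenchelOfReal

lemma ConvexOn.isProperConvexLSC_coe {F : Type*} [NormedAddCommGroup F] [InnerProductSpace ℝ F]
    [FiniteDimensional ℝ F] {V : F → ℝ} (hV : ConvexOn ℝ univ V) :
    IsProperConvexLSC (fun x => (V x : EReal)) := by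
  refine ⟨fun x y a b ha hb hab => ?_, ?_, fun x => EReal.coe_ne_bot _, 0, EReal.coe_ne_top _⟩
  · have := hV.2 (mem_univ x) (mem_univ y) ha hb hab
    simp only [smul_eq_mul] at this
    beta_reduce
    exact_mod_cast this
  · exact (continuous_coe_real_ereal.comp hV.locallyLipschitz.continuous).lowerSemicontinuous

section FinitePotential

variable {n : ℕ} {V : EuclideanSpace ℝ (Fin n) → ℝ}

lemma lintegral_exp_neg_eq (h1 : Integrable (fun x => Real.exp (-V x))) :
    ∫⁻ x, ENNReal.ofReal (Real.exp (-V x)) = ENNReal.ofReal (∫ x, Real.exp (-V x)) :=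
  (ofReal_integral_eq_lintegral_ofReal h1 (ae_of_all _ fun _ => (Real.exp_pos _).le)).symm

lemma probOf_eq (h1 : Integrable (fun x => Real.exp (-V x))) :
    probOf V = ENNReal.ofReal (∫ x, Real.exp (-V x))⁻¹ •
      volume.withDensity (fun x => ENNReal.ofReal (Real.exp (-V x))) := by
  rw [probOf, lintegral_exp_neg_eq h1, ENNReal.ofReal_inv_of_pos (integral_exp_pos h1)]

lemma integral_probOf (hV : Continuous V) (h1 : Integrable (fun x => Real.exp (-V x)))
    (g : EuclideanSpace ℝ (Fin n) → ℝ) :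
    ∫ x, g x ∂probOf V = (∫ x, Real.exp (-V x))⁻¹ * ∫ x, g x * Real.exp (-V x) := by
  have hZ := integral_exp_pos h1
  rw [probOf_eq h1, integral_smul_measure,
    integral_withDensity_eq_integral_toReal_smul (by fun_prop) (by simp),
    ENNReal.toReal_ofReal (by positivity), smul_eq_mul]
  congr 2
  ext x
  rw [ENNReal.toReal_ofReal (Real.exp_pos _).le, smul_eq_mul, mul_comm]

lemma integrable_probOf (hV : Continuous V) (h1 : Integrable (fun x => Real.exp (-V x)))
    {g : EuclideanSpace ℝ (Fin n) → ℝ} (hg : Integrable (fun x => g x * Real.exp (-V x))) :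
    Integrable g (probOf V) := by
  rw [probOf_eq h1]
  refine Integrable.smul_measure ?_ ENNReal.ofReal_ne_top
  rw [integrable_withDensity_iff (by fun_prop) (by simp)]
  simpa [ENNReal.toReal_ofReal (Real.exp_pos _).le] using hg

lemma probOf_absolutelyContinuous (V : EuclideanSpace ℝ (Fin n) → ℝ) : probOf V ≪ volume :=
  Measure.AbsolutelyContinuous.smul_left (withDensity_absolutelyContinuous _ _) _

lemma relEnt_probOf (hV : Continuous V) (h1 : Integrable (fun x => Real.exp (-V x)))
    (h2 : Integrable (fun x => V x * Real.exp (-V x))) :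
    relEnt (probOf V) = -((∫ x, Real.exp (-V x))⁻¹ * ∫ x, V x * Real.exp (-V x))
      - Real.log (∫ x, Real.exp (-V x)) := by
  have hZ := integral_exp_pos h1
  set Z := ∫ x, Real.exp (-V x) with hZdef
  have hd : ∀ᵐ x ∂probOf V, Real.log (((probOf V).rnDeriv volume x).toReal)
      = -V x - Real.log Z := by
    refine (probOf_absolutelyContinuous V).ae_le ?_
    have he : probOf V
        = volume.withDensity (fun x => ENNReal.ofReal (Z⁻¹ * Real.exp (-V x))) := by
      rw [probOf_eq h1, ← withDensity_smul _ (by fun_prop)]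
      congr 1
      ext x
      rw [Pi.smul_apply, smul_eq_mul, ENNReal.ofReal_mul (by positivity)]
    have hr := Measure.rnDeriv_withDensity (volume : Measure (EuclideanSpace ℝ (Fin n)))
      (f := fun x => ENNReal.ofReal (Z⁻¹ * Real.exp (-V x))) (by fun_prop)
    rw [he]
    filter_upwards [hr] with x hx
    rw [hx, ENNReal.toReal_ofReal (by positivity), Real.log_mul (by positivity) (by positivity),
      Real.log_exp, Real.log_inv]
    ring
  rw [relEnt, integral_congr_ae hd, integral_probOf hV h1]
  have hs : (fun x => (-V x - Real.log Z) * Real.exp (-V x))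
      = fun x => -(V x * Real.exp (-V x)) - Real.log Z * Real.exp (-V x) := by
    ext x; ring
  have h2' : Integrable (fun x => -(V x * Real.exp (-V x))) := h2.neg
  rw [hs, integral_sub h2' (h1.const_mul _), integral_neg, integral_const_mul, ← hZdef]
  field_simp

lemma eintegral_map_gradient_fenchelR_le (hV : ConvexOn ℝ univ V)
    (h1 : Integrable (fun x => Real.exp (-V x)))
    (h2 : Integrable (fun x => V x * Real.exp (-V x))) :
    eintegral (Measure.map (gradient V) (probOf V)) (fenchelR V)
      ≤ ((n - (∫ x, Real.exp (-V x))⁻¹ * ∫ x, V x * Real.exp (-V x) : ℝ) : EReal) := by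
  have hVc : Continuous V := hV.locallyLipschitz.continuous
  have hZ := integral_exp_pos h1
  obtain ⟨h3, h4⟩ := hV.integrable_inner_gradient_mul_exp_neg volume h1 h2
  rw [finrank_euclideanSpace_fin] at h4
  have hs : (fun x => (⟪gradient V x, x⟫_ℝ - V x) * Real.exp (-V x))
      = fun x => ⟪gradient V x, x⟫_ℝ * Real.exp (-V x) - V x * Real.exp (-V x) := by
    ext x; ring
  rw [eintegral_map (measurable_gradient V) (lowerSemicontinuous_fenchelR V).measurable]
  have hle : ∀ᵐ x ∂probOf V, (fenchelR V ∘ gradient V) x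
      ≤ ((⟪gradient V x, x⟫_ℝ - V x : ℝ) : EReal) := by
    refine (probOf_absolutelyContinuous V).ae_le ?_
    filter_upwards [hV.ae_differentiableAt volume] with x hx
    refine iSup_le fun z => EReal.coe_le_coe_iff.2 ?_
    have := hV.add_inner_gradient_le hx z
    rw [inner_sub_right, real_inner_comm z] at this
    linarith
  refine (eintegral_mono_ae hle).trans ?_
  rw [eintegral_coe (integrable_probOf hVc h1 (by rw [hs]; exact h3.sub h2)),
    EReal.coe_le_coe_iff, integral_probOf hVc h1, hs, integral_sub h3 h2, mul_sub]
  have := mul_le_mul_of_nonneg_left h4 (inv_pos.2 hZ).le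
  have hc : (∫ x, Real.exp (-V x))⁻¹ * (n * ∫ x, Real.exp (-V x)) = n := by field_simp
  linarith

lemma le_mul_lintegral_of_relEnt_le_mcCost {c : ℝ} (hc : 0 < c)
    {Vs : EuclideanSpace ℝ (Fin n) → ℝ}
    (hV : ConvexOn ℝ univ V) (hVs : ∀ y, (Vs y : EReal) = fenchelR V y)
    {a b a' b' : ℝ} (ha : 0 < a) (hb : ∀ x, a * ‖x‖ - b ≤ V x)
    (ha' : 0 < a') (hb' : ∀ y, a' * ‖y‖ - b' ≤ Vs y)
    (hyp : ((relEnt (probOf V) + relEnt (probOf Vs) : ℝ) : EReal)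
        ≤ ((-(n * Real.log (c * Real.exp 2)) : ℝ) : EReal)
          + mcCost (Measure.map (gradient V) (probOf V))
              (Measure.map (gradient Vs) (probOf Vs))) :
    ENNReal.ofReal (c ^ n) ≤ (∫⁻ x, ENNReal.ofReal (Real.exp (-V x)))
      * ∫⁻ y, ENNReal.ofReal (Real.exp (-Vs y)) := by
  have hVsc := convexOn_of_eq_fenchelR hVs
  have hc1 : Continuous V := hV.locallyLipschitz.continuous
  have hc2 : Continuous Vs := hVsc.locallyLipschitz.continuous
  have i1 := integrable_exp_neg_of_linear_le volume hc1 ha hb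
  have i2 := integrable_mul_exp_neg_of_linear_le volume hc1 ha hb
  have j1 := integrable_exp_neg_of_linear_le volume hc2 ha' hb'
  have j2 := integrable_mul_exp_neg_of_linear_le volume hc2 ha' hb'
  have hZ := integral_exp_pos i1
  have hZs := integral_exp_pos j1
  have hcost : mcCost (Measure.map (gradient V) (probOf V))
      (Measure.map (gradient Vs) (probOf Vs))
      ≤ ((n - (∫ x, Real.exp (-V x))⁻¹ * ∫ x, V x * Real.exp (-V x) : ℝ) : EReal)
        + ((n - (∫ x, Real.exp (-Vs x))⁻¹ * ∫ x, Vs x * Real.exp (-Vs x) : ℝ) : EReal) := by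
    refine (iInf_le _ ⟨_, hVsc.isProperConvexLSC_coe⟩).trans (add_le_add ?_ ?_)
    · simp only [hVs]
      exact eintegral_map_gradient_fenchelR_le hV i1 i2
    · simp only [fenchel_coe]
      exact eintegral_map_gradient_fenchelR_le hVsc j1 j2
  have h := hyp.trans (add_le_add le_rfl hcost)
  rw [relEnt_probOf hc1 i1 i2, relEnt_probOf hc2 j1 j2, ← EReal.coe_add, ← EReal.coe_add,
    EReal.coe_le_coe_iff, Real.log_mul hc.ne' (Real.exp_pos 2).ne', Real.log_exp] at h
  rw [lintegral_exp_neg_eq i1, lintegral_exp_neg_eq j1, ← ENNReal.ofReal_mul hZ.le]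
  refine ENNReal.ofReal_le_ofReal ?_
  rw [← Real.log_le_log_iff (by positivity) (by positivity), Real.log_pow,
    Real.log_mul hZ.ne' hZs.ne']
  linarith

end FinitePotential

lemma ConvexOn.exists_lt_of_lintegral_ne_top {F : Type*} [NormedAddCommGroup F]
    [InnerProductSpace ℝ F] [MeasurableSpace F] [BorelSpace F]
    (μ : Measure F) [μ.IsAddHaarMeasure] {D : Set F} {h : F → ℝ} (hh : ConvexOn ℝ D h)
    {φ : F → ℝ≥0∞} (hφ : ∫⁻ x, φ x ∂μ ≠ ⊤)
    (hφD : ∀ x ∈ D, ENNReal.ofReal (Real.exp (-h x)) ≤ φ x) {x₀ : F} {r M : ℝ} (hr : 0 < r)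
    (hrD : Metric.ball x₀ r ⊆ D) (hrM : ∀ x ∈ Metric.ball x₀ r, h x ≤ M) :
    ∃ R > 0, ∀ x ∈ D, R ≤ ‖x - x₀‖ → M + 1 < h x := by
  set v := μ (Metric.ball (0 : F) (r / 2)) with hv
  have hv0 : v ≠ 0 := (Metric.measure_ball_pos μ 0 (half_pos hr)).ne'
  set w := ENNReal.ofReal (Real.exp (-(M + 1))) with hw
  have hw0 : w ≠ 0 := by simp [hw, Real.exp_pos]
  obtain ⟨N, hN⟩ := ENNReal.exists_nat_mul_gt (mul_ne_zero hw0 hv0) hφ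
  refine ⟨2 * N * r + 1, by positivity, fun x hxD hx => ?_⟩
  by_contra! hle
  set L := ‖x - x₀‖ with hL
  have hLpos : 0 < L := by
    have : 0 ≤ 2 * N * r := by positivity
    linarith
  set e : F := L⁻¹ • (x - x₀) with he
  have hnorm : ‖e‖ = 1 := by
    rw [he, norm_smul, Real.norm_of_nonneg (by positivity), ← hL]; field_simp
  set p : ℕ → F := fun k => x₀ + (k * r) • e with hp
  have hdisj : Set.PairwiseDisjoint (↑(Finset.range N))
      (fun k => Metric.ball (p k) (r / 2)) := by
    intro i _ j _ hij
    refine Metric.ball_disjoint_ball ?_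
    rw [dist_eq_norm]
    have : p i - p j = (((i : ℝ) - j) * r) • e := by simp only [hp]; module
    rw [this, norm_smul, hnorm, mul_one, norm_mul, Real.norm_of_nonneg hr.le, add_halves]
    have h1 : (1 : ℝ) ≤ ‖(i : ℝ) - j‖ := by
      rw [Real.norm_eq_abs]
      have : (1 : ℤ) ≤ |(i : ℤ) - j| := Int.one_le_abs (sub_ne_zero.2 (by exact_mod_cast hij))
      exact_mod_cast this
    nlinarith
  have hball : ∀ k ∈ Finset.range N, ∀ y ∈ Metric.ball (p k) (r / 2), w ≤ φ y := by
    intro k hk y hy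
    have hkN : (k : ℝ) ≤ N := by exact_mod_cast (Finset.mem_range.1 hk).le
    set t : ℝ := k * r / L with ht
    have ht0 : 0 ≤ t := by positivity
    have ht1 : t ≤ 1 / 2 := by
      rw [ht, div_le_iff₀ hLpos]; nlinarith
    set q : F := x₀ + (1 - t)⁻¹ • (y - p k) with hq
    have h1t : 0 < 1 - t := by linarith
    have hqb : q ∈ Metric.ball x₀ r := by
      rw [Metric.mem_ball, dist_eq_norm] at hy ⊢
      rw [hq, add_sub_cancel_left, norm_smul, Real.norm_of_nonneg (by positivity),
        inv_mul_lt_iff₀ h1t]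
      nlinarith
    have hy' : t • x + (1 - t) • q = y := by
      have h2 : (1 - t) • (1 - t)⁻¹ • (y - p k) = y - p k := smul_inv_smul₀ h1t.ne' _
      have h3 : t • (x - x₀) = (k * r) • e := by rw [he, smul_smul, ht, div_eq_mul_inv]
      have h4 : t • x + (1 - t) • q
          = t • (x - x₀) + x₀ + (1 - t) • (1 - t)⁻¹ • (y - p k) := by rw [hq]; module
      rw [h4, h2, h3]; simp only [hp]; module
    have hyD : y ∈ D := hy' ▸ hh.1 hxD (hrD hqb) ht0 h1t.le (by ring)
    have hyh : h y ≤ M + 1 := by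
      have h5 := hh.2 hxD (hrD hqb) ht0 h1t.le (by ring)
      rw [hy'] at h5
      have h6 := hrM q hqb
      simp only [smul_eq_mul] at h5
      nlinarith
    exact (ENNReal.ofReal_le_ofReal (Real.exp_le_exp.2 (by linarith))).trans (hφD y hyD)
  refine absurd hN (not_lt.2 ?_)
  calc (N : ℝ≥0∞) * (w * v) = ∑ k ∈ Finset.range N, ∫⁻ _ in Metric.ball (p k) (r / 2), w ∂μ := by
        simp [hv, Measure.addHaar_ball_center]
    _ ≤ ∑ k ∈ Finset.range N, ∫⁻ y in Metric.ball (p k) (r / 2), φ y ∂μ :=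
        Finset.sum_le_sum fun k hk => setLIntegral_mono' measurableSet_ball (hball k hk)
    _ = ∫⁻ y in ⋃ k ∈ Finset.range N, Metric.ball (p k) (r / 2), φ y ∂μ :=
        (lintegral_biUnion_finset hdisj (fun _ _ => measurableSet_ball) _).symm
    _ ≤ ∫⁻ y, φ y ∂μ := setLIntegral_le_lintegral _ _

section Coercivity

variable {F : Type*} [NormedAddCommGroup F] [InnerProductSpace ℝ F] [FiniteDimensional ℝ F]

lemma Convex.interior_nonempty_of_measure_ne_zero [MeasurableSpace F] [BorelSpace F]
    (μ : Measure F) [μ.IsAddHaarMeasure] {D : Set F} (hD : Convex ℝ D) (h : μ D ≠ 0) :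
    (interior D).Nonempty := by
  by_contra hne
  rw [not_nonempty_iff_eq_empty] at hne
  refine h (measure_mono_null (fun x hx => ?_) (hD.addHaar_frontier μ))
  rw [frontier, hne, sdiff_empty]
  exact subset_closure hx

lemma ConvexOn.exists_ball_subset_le {D : Set F} {h : F → ℝ} (hh : ConvexOn ℝ D h) {x₀ : F}
    (hx₀ : x₀ ∈ interior D) :
    ∃ r > 0, ∃ M, Metric.ball x₀ r ⊆ D ∧ ∀ x ∈ Metric.ball x₀ r, h x ≤ M := by
  have hc : ContinuousAt h x₀ :=
    hh.continuousOn_interior.continuousAt (isOpen_interior.mem_nhds hx₀)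
  have h1 : ∀ᶠ x in nhds x₀, h x < h x₀ + 1 := hc.eventually_lt continuousAt_const (by linarith)
  obtain ⟨r, hr, hrs⟩ := Metric.eventually_nhds_iff_ball.1
    (h1.and (mem_interior_iff_mem_nhds.1 hx₀))
  exact ⟨r, hr, h x₀ + 1, fun x hx => (hrs x hx).2, fun x hx => (hrs x hx).1.le⟩

/-- A convex function with an affine lower bound, finite near some point, and with
integrable exponential `exp (-h)`, grows at least linearly. -/
lemma ConvexOn.exists_linear_le [MeasurableSpace F] [BorelSpace F]
    (μ : Measure F) [μ.IsAddHaarMeasure] {D : Set F} {h : F → ℝ} (hh : ConvexOn ℝ D h)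
    {φ : F → ℝ≥0∞} (hφ : ∫⁻ x, φ x ∂μ ≠ ⊤)
    (hφD : ∀ x ∈ D, ENNReal.ofReal (Real.exp (-h x)) ≤ φ x) (hD : (interior D).Nonempty)
    {C : ℝ} (hC : 0 ≤ C) (hlow : ∀ x ∈ D, -(C * (1 + ‖x‖)) ≤ h x) :
    ∃ a > 0, ∃ b, ∀ x ∈ D, a * ‖x‖ - b ≤ h x := by
  obtain ⟨x₀, hx₀⟩ := hD
  obtain ⟨r, hr, M, hrD, hrM⟩ := hh.exists_ball_subset_le hx₀
  obtain ⟨R, hR, hRM⟩ := hh.exists_lt_of_lintegral_ne_top μ hφ hφD hr hrD hrM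
  have hx₀M := hrM x₀ (Metric.mem_ball_self hr)
  have hx₀D := interior_subset hx₀
  refine ⟨R⁻¹, inv_pos.2 hR, |M| + R⁻¹ * (‖x₀‖ + R) + C * (1 + ‖x₀‖ + R), fun x hx => ?_⟩
  have htri : ‖x‖ ≤ ‖x₀‖ + ‖x - x₀‖ := by
    simpa using norm_add_le x₀ (x - x₀)
  have hRi : 0 < R⁻¹ := inv_pos.2 hR
  have hM := neg_abs_le M
  have hRR : R⁻¹ * R = 1 := inv_mul_cancel₀ hR.ne'
  have hCpos : 0 ≤ C * (1 + ‖x₀‖ + R) := by positivity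
  have htri' := mul_le_mul_of_nonneg_left htri hRi.le
  rcases le_or_gt R ‖x - x₀‖ with hcase | hcase
  · set L := ‖x - x₀‖ with hL
    have hLpos : 0 < L := hR.trans_le hcase
    set t := R / L with ht
    have ht0 : 0 < t := by positivity
    have ht1 : t ≤ 1 := (div_le_one hLpos).2 hcase
    have hz := hh.1 hx hx₀D ht0.le (sub_nonneg.2 ht1) (by ring)
    have hzn : ‖t • x + (1 - t) • x₀ - x₀‖ = R := by
      have : t • x + (1 - t) • x₀ - x₀ = t • (x - x₀) := by module
      rw [this, norm_smul, Real.norm_of_nonneg ht0.le, ← hL, ht]; field_simp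
    have h1 := hRM _ hz hzn.ge
    have h2 := hh.2 hx hx₀D ht0.le (sub_nonneg.2 ht1) (by ring)
    simp only [smul_eq_mul] at h2
    have h3 : 1 ≤ t * (h x - M) := by nlinarith
    have h4 : R⁻¹ * L ≤ h x - M := by
      have : R⁻¹ * L = t⁻¹ := by rw [ht, inv_div]; field_simp
      rw [this, inv_le_iff_one_le_mul₀' ht0]
      exact h3
    nlinarith
  · have h1 := hlow x hx
    have h2 : C * (1 + ‖x‖) ≤ C * (1 + ‖x₀‖ + R) :=
      mul_le_mul_of_nonneg_left (by linarith) hC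
    have h3 : R⁻¹ * ‖x‖ ≤ R⁻¹ * (‖x₀‖ + R) := by gcongr; linarith
    linarith [abs_nonneg M]

end Coercivity

section EffectiveDomain

variable {F : Type*} [NormedAddCommGroup F] [InnerProductSpace ℝ F] {f : F → EReal}

lemma ConvexEReal.convexOn_toReal (hf : ConvexEReal f) (hbot : ∀ x, f x ≠ ⊥) :
    ConvexOn ℝ {x | f x ≠ ⊤} (fun x => (f x).toReal) := by
  have key : ∀ x, f x ≠ ⊤ → ∀ y, f y ≠ ⊤ → ∀ a b : ℝ, 0 ≤ a → 0 ≤ b → a + b = 1 →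
      f (a • x + b • y) ≤ ((a * (f x).toReal + b * (f y).toReal : ℝ) : EReal) := by
    intro x hx y hy a b ha hb hab
    have := hf x y a b ha hb hab
    rw [← EReal.coe_toReal hx (hbot x), ← EReal.coe_toReal hy (hbot y)] at this
    exact_mod_cast this
  refine ⟨fun x hx y hy a b ha hb hab => ?_, fun x hx y hy a b ha hb hab => ?_⟩
  · exact ne_top_of_le_ne_top (EReal.coe_ne_top _) (key x hx y hy a b ha hb hab)
  · have h1 := key x hx y hy a b ha hb hab
    have h2 := ne_top_of_le_ne_top (EReal.coe_ne_top _) h1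
    rw [← EReal.coe_toReal h2 (hbot _), EReal.coe_le_coe_iff] at h1
    simpa using h1

lemma fenchel_ne_bot {x : F} (hx : f x ≠ ⊤) (hbot : f x ≠ ⊥) (y : F) : fenchel f y ≠ ⊥ := by
  have h := le_iSup (fun x : F => (⟪x, y⟫_ℝ : EReal) - f x) x
  refine ne_bot_of_le_ne_bot ?_ h
  rw [← EReal.coe_toReal hx hbot, ← EReal.coe_sub]
  exact EReal.coe_ne_bot _

lemma inner_sub_toReal_le_fenchel {x : F} (hx : f x ≠ ⊤) (hbot : f x ≠ ⊥) (y : F) :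
    ((⟪x, y⟫_ℝ - (f x).toReal : ℝ) : EReal) ≤ fenchel f y := by
  have h := le_iSup (fun x : F => (⟪x, y⟫_ℝ : EReal) - f x) x
  refine le_trans (le_of_eq ?_) h
  rw [EReal.coe_sub, EReal.coe_toReal hx hbot]

lemma inner_sub_toReal_le_toReal_fenchel {x y : F} (hx : f x ≠ ⊤) (hbot : f x ≠ ⊥)
    (hy : fenchel f y ≠ ⊤) : ⟪x, y⟫_ℝ - (f x).toReal ≤ (fenchel f y).toReal := by
  have h := inner_sub_toReal_le_fenchel hx hbot y
  rwa [← EReal.coe_toReal hy (fenchel_ne_bot hx hbot y), EReal.coe_le_coe_iff] at h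

lemma fenchel_le_coe (hbot : ∀ x, f x ≠ ⊥) {y : F} {M : ℝ}
    (h : ∀ x, f x ≠ ⊤ → ⟪x, y⟫_ℝ - (f x).toReal ≤ M) : fenchel f y ≤ (M : EReal) := by
  refine iSup_le fun x => ?_
  by_cases hx : f x = ⊤
  · simp [hx]
  · rw [← EReal.coe_toReal hx (hbot x), ← EReal.coe_sub, EReal.coe_le_coe_iff]
    exact h x hx

lemma convexOn_toReal_fenchel (hbot : ∀ x, f x ≠ ⊥) (htop : ∃ x, f x ≠ ⊤) :
    ConvexOn ℝ {y | fenchel f y ≠ ⊤} (fun y => (fenchel f y).toReal) := by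
  have key : ∀ y, fenchel f y ≠ ⊤ → ∀ z, fenchel f z ≠ ⊤ → ∀ a b : ℝ, 0 ≤ a → 0 ≤ b →
      a + b = 1 → fenchel f (a • y + b • z)
        ≤ ((a * (fenchel f y).toReal + b * (fenchel f z).toReal : ℝ) : EReal) := by
    intro y hy z hz a b ha hb hab
    refine fenchel_le_coe hbot fun x hx => ?_
    have h1 := mul_le_mul_of_nonneg_left (inner_sub_toReal_le_toReal_fenchel hx (hbot x) hy) ha
    have h2 := mul_le_mul_of_nonneg_left (inner_sub_toReal_le_toReal_fenchel hx (hbot x) hz) hb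
    rw [inner_add_right, inner_smul_right, inner_smul_right]
    obtain rfl : a = 1 - b := by linarith
    linarith
  obtain ⟨x₀, hx₀⟩ := htop
  refine ⟨fun x hx y hy a b ha hb hab => ?_, fun x hx y hy a b ha hb hab => ?_⟩
  · exact ne_top_of_le_ne_top (EReal.coe_ne_top _) (key x hx y hy a b ha hb hab)
  · have h1 := key x hx y hy a b ha hb hab
    have h2 := ne_top_of_le_ne_top (EReal.coe_ne_top _) h1
    rw [← EReal.coe_toReal h2 (fenchel_ne_bot hx₀ (hbot x₀) _), EReal.coe_le_coe_iff] at h1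
    simpa using h1

lemma expNeg_eq_exp {t : EReal} (h1 : t ≠ ⊤) (h2 : t ≠ ⊥) :
    expNeg t = Real.exp (-t.toReal) := by simp [expNeg, h1, h2]

lemma measure_ne_top_set_ne_zero {α : Type*} [MeasurableSpace α] {μ : Measure α} {g : α → EReal}
    (h : 0 < ∫⁻ x, ENNReal.ofReal (expNeg (g x)) ∂μ) : μ {x | g x ≠ ⊤} ≠ 0 := by
  intro h0
  refine h.ne' ?_
  rw [← lintegral_zero (μ := μ)]
  refine lintegral_congr_ae ?_
  have : ∀ᵐ x ∂μ, g x = ⊤ := by rw [ae_iff]; exact h0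
  filter_upwards [this] with x hx
  simp [expNeg, hx]

variable [FiniteDimensional ℝ F] [MeasurableSpace F] [BorelSpace F]
  (μ : Measure F) [μ.IsAddHaarMeasure]

lemma IsProperConvexLSC.exists_linear_le (hf : IsProperConvexLSC f)
    (h1 : 0 < ∫⁻ x, ENNReal.ofReal (expNeg (f x)) ∂μ)
    (h2 : ∫⁻ x, ENNReal.ofReal (expNeg (f x)) ∂μ ≠ ⊤)
    (h3 : ∃ y, fenchel f y ≠ ⊤) :
    ∃ a > 0, ∃ b, ∀ x, f x ≠ ⊤ → a * ‖x‖ - b ≤ (f x).toReal := by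
  obtain ⟨hc, -, hbot, -⟩ := hf
  obtain ⟨y₀, hy₀⟩ := h3
  have hcv := hc.convexOn_toReal hbot
  refine hcv.exists_linear_le μ h2 (fun x hx => ?_)
    (hcv.1.interior_nonempty_of_measure_ne_zero μ (measure_ne_top_set_ne_zero h1))
    (C := ‖y₀‖ + |(fenchel f y₀).toReal|) (by positivity) (fun x hx => ?_)
  · rw [expNeg_eq_exp hx (hbot x)]
  · have h4 := inner_sub_toReal_le_toReal_fenchel hx (hbot x) hy₀
    have h5 := neg_le_of_abs_le (abs_real_inner_le_norm x y₀)
    have h6 := le_abs_self (fenchel f y₀).toReal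
    have h7 := norm_nonneg x
    have h8 := norm_nonneg y₀
    have h9 := abs_nonneg (fenchel f y₀).toReal
    nlinarith

lemma IsProperConvexLSC.exists_linear_le_fenchel (hf : IsProperConvexLSC f)
    (h1 : 0 < ∫⁻ y, ENNReal.ofReal (expNeg (fenchel f y)) ∂μ)
    (h2 : ∫⁻ y, ENNReal.ofReal (expNeg (fenchel f y)) ∂μ ≠ ⊤) :
    ∃ a > 0, ∃ b, ∀ y, fenchel f y ≠ ⊤ → a * ‖y‖ - b ≤ (fenchel f y).toReal := by
  obtain ⟨-, -, hbot, htop⟩ := hf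
  have hcv := convexOn_toReal_fenchel hbot htop
  obtain ⟨x₀, hx₀⟩ := htop
  refine hcv.exists_linear_le μ h2 (fun y hy => ?_)
    (hcv.1.interior_nonempty_of_measure_ne_zero μ (measure_ne_top_set_ne_zero h1))
    (C := ‖x₀‖ + |(f x₀).toReal|) (by positivity) (fun y hy => ?_)
  · rw [expNeg_eq_exp hy (fenchel_ne_bot hx₀ (hbot x₀) y)]
  · have h4 := inner_sub_toReal_le_toReal_fenchel hx₀ (hbot x₀) hy
    have h5 := neg_le_of_abs_le (abs_real_inner_le_norm x₀ y)
    have h6 := le_abs_self (f x₀).toReal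
    have h7 := norm_nonneg x₀
    have h8 := norm_nonneg y
    have h9 := abs_nonneg (f x₀).toReal
    nlinarith

/-- If `exp (-f*)` has positive finite integral and `f` is finite on a set of nonempty interior,
then `0` is interior to the domain of `f`. -/
lemma IsProperConvexLSC.zero_mem_interior (hf : IsProperConvexLSC f)
    (hD : (interior {x | f x ≠ ⊤}).Nonempty)
    (h1 : 0 < ∫⁻ y, ENNReal.ofReal (expNeg (fenchel f y)) ∂μ)
    (h2 : ∫⁻ y, ENNReal.ofReal (expNeg (fenchel f y)) ∂μ ≠ ⊤) :
    (0 : F) ∈ interior {x | f x ≠ ⊤} := by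
  by_contra h0
  obtain ⟨a, ha, b, hab⟩ := hf.exists_linear_le_fenchel μ h1 h2
  obtain ⟨hc, -, hbot, -⟩ := hf
  have hcv := (hc.convexOn_toReal hbot).1
  obtain ⟨ℓ, hℓ⟩ := geometric_hahn_banach_open_point hcv.interior isOpen_interior h0
  obtain ⟨y₀, hy₀⟩ : ∃ y, fenchel f y ≠ ⊤ := by
    by_contra! hcon
    exact measure_ne_top_set_ne_zero h1 (by simp [hcon])
  have hle : ∀ x, f x ≠ ⊤ → ℓ x ≤ 0 := by
    intro x hx
    have hcl : x ∈ closure (interior {x | f x ≠ ⊤}) := by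
      rw [hcv.closure_interior_eq_closure_of_nonempty_interior hD]
      exact subset_closure hx
    refine closure_minimal (t := {x | ℓ x ≤ 0}) (fun z hz => ?_)
      (isClosed_le ℓ.continuous continuous_const) hcl
    have := (hℓ z hz).le
    rwa [map_zero] at this
  set u : F := (InnerProductSpace.toDual ℝ F).symm ℓ with hu
  have hul : ∀ x, ⟪x, u⟫_ℝ = ℓ x := fun x => by
    rw [real_inner_comm, hu, InnerProductSpace.toDual_symm_apply]
  have hu0 : u ≠ 0 := by
    intro hz
    obtain ⟨z, hz'⟩ := hD
    have := hℓ z hz'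
    rw [← hul z, hz] at this
    simp at this
  have hun : 0 < ‖u‖ := norm_pos_iff.2 hu0
  have hbd : ∀ t : ℝ, 0 ≤ t → a * (t * ‖u‖ - ‖y₀‖) - b ≤ (fenchel f y₀).toReal := by
    intro t ht
    have h3 : fenchel f (y₀ + t • u) ≤ ((fenchel f y₀).toReal : EReal) := by
      refine fenchel_le_coe hbot fun x hx => ?_
      have h4 := inner_sub_toReal_le_toReal_fenchel hx (hbot x) hy₀
      rw [inner_add_right, inner_smul_right, hul]
      have := hle x hx
      nlinarith
    have h4 : fenchel f (y₀ + t • u) ≠ ⊤ := ne_top_of_le_ne_top (EReal.coe_ne_top _) h3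
    have h5 := hab _ h4
    have h6 : (fenchel f (y₀ + t • u)).toReal ≤ (fenchel f y₀).toReal := by
      by_cases hb : fenchel f (y₀ + t • u) = ⊥
      · obtain ⟨z, hz⟩ := hD
        exact absurd hb (fenchel_ne_bot (interior_subset hz) (hbot z) _)
      · rwa [← EReal.coe_toReal h4 hb, EReal.coe_le_coe_iff] at h3
    have h7 : t * ‖u‖ - ‖y₀‖ ≤ ‖y₀ + t • u‖ := by
      have := norm_sub_norm_le (t • u) (-y₀)
      rw [norm_smul, Real.norm_of_nonneg ht, norm_neg, sub_neg_eq_add, add_comm (t • u)] at this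
      exact this
    nlinarith
  have h8 := hbd ((|(fenchel f y₀).toReal| + |b| + 1 + a * ‖y₀‖) / (a * ‖u‖)) (by positivity)
  have h9 : a * ((|(fenchel f y₀).toReal| + |b| + 1 + a * ‖y₀‖) / (a * ‖u‖) * ‖u‖)
      = |(fenchel f y₀).toReal| + |b| + 1 + a * ‖y₀‖ := by field_simp
  rw [mul_sub, h9] at h8
  linarith [le_abs_self (fenchel f y₀).toReal, le_abs_self b]

end EffectiveDomain

section Regularization

variable {F : Type*} [NormedAddCommGroup F]

/-- The infimal convolution of `h + (ε / 2) ‖·‖²`, restricted to `D`, with `‖·‖² / (2 ε)`. -/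
def regPotential (D : Set F) (h : F → ℝ) (ε : ℝ) (x : F) : ℝ :=
  ⨅ z : D, (h z + ε / 2 * ‖(z : F)‖ ^ 2 + (2 * ε)⁻¹ * ‖x - z‖ ^ 2)

variable {D : Set F} {h : F → ℝ} {a b ε : ℝ}

lemma regPotential_le (ha : 0 < a) (hlow : ∀ z ∈ D, a * ‖z‖ - b ≤ h z) (hε : 0 < ε)
    {z : F} (hz : z ∈ D) (x : F) :
    regPotential D h ε x ≤ h z + ε / 2 * ‖z‖ ^ 2 + (2 * ε)⁻¹ * ‖x - z‖ ^ 2 := by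
  refine ciInf_le (f := fun z : D =>
    h z + ε / 2 * ‖(z : F)‖ ^ 2 + (2 * ε)⁻¹ * ‖x - z‖ ^ 2) ⟨-b, ?_⟩ ⟨z, hz⟩
  rintro _ ⟨w, rfl⟩
  have h1 := hlow w w.2
  have h2 : 0 ≤ a * ‖(w : F)‖ := by positivity
  have h3 : 0 ≤ ε / 2 * ‖(w : F)‖ ^ 2 := by positivity
  have h4 : 0 ≤ (2 * ε)⁻¹ * ‖x - w‖ ^ 2 := by positivity
  beta_reduce
  linarith

lemma le_regPotential (hD : D.Nonempty) {x : F} {s : ℝ}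
    (hs : ∀ z ∈ D, s ≤ h z + ε / 2 * ‖z‖ ^ 2 + (2 * ε)⁻¹ * ‖x - z‖ ^ 2) :
    s ≤ regPotential D h ε x :=
  have := hD.to_subtype
  le_ciInf fun z => hs z z.2

lemma linear_le_regPotential (ha : 0 < a) (hlow : ∀ z ∈ D, a * ‖z‖ - b ≤ h z) (hε : 0 < ε)
    (hε1 : ε ≤ 1) (hD : D.Nonempty) (x : F) :
    a * ‖x‖ - (b + a ^ 2 / 2) ≤ regPotential D h ε x := by
  refine le_regPotential hD fun z hz => ?_
  have h1 := hlow z hz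
  have h2 : ‖x‖ ≤ ‖z‖ + ‖x - z‖ := by simpa using norm_add_le z (x - z)
  have h3 : 0 ≤ ε / 2 * ‖z‖ ^ 2 := by positivity
  have h4 : (2 : ℝ)⁻¹ * ‖x - z‖ ^ 2 ≤ (2 * ε)⁻¹ * ‖x - z‖ ^ 2 := by
    gcongr; linarith
  have h5 := mul_le_mul_of_nonneg_left h2 ha.le
  nlinarith [sq_nonneg (a - ‖x - z‖)]

open Filter Topology

lemma eventually_le_regPotential (ha : 0 < a) (hlow : ∀ z ∈ D, a * ‖z‖ - b ≤ h z)
    (hD : D.Nonempty) {x : F} {s : ℝ} (hs : ∀ᶠ z in 𝓝 x, z ∈ D → s ≤ h z) :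
    ∀ᶠ ε in 𝓝[>] (0 : ℝ), s ≤ regPotential D h ε x := by
  obtain ⟨δ, hδ, hball⟩ := Metric.eventually_nhds_iff_ball.1 hs
  have h1 : ∀ᶠ ε in 𝓝[>] (0 : ℝ), ε < δ ^ 2 / (2 * (|s + b| + 1)) :=
    nhdsWithin_le_nhds (Iio_mem_nhds (by positivity))
  filter_upwards [self_mem_nhdsWithin, h1] with ε hε hεδ
  replace hε : 0 < ε := hε
  refine le_regPotential hD fun z hz => ?_
  have h3 : 0 ≤ ε / 2 * ‖z‖ ^ 2 := by positivity
  rcases lt_or_ge (dist z x) δ with hlt | hge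
  · have h4 : 0 ≤ (2 * ε)⁻¹ * ‖x - z‖ ^ 2 := by positivity
    linarith [hball z hlt hz]
  · rw [dist_comm, dist_eq_norm] at hge
    have h4 : (2 * ε)⁻¹ * δ ^ 2 ≤ (2 * ε)⁻¹ * ‖x - z‖ ^ 2 := by gcongr
    have h5 : |s + b| + 1 ≤ (2 * ε)⁻¹ * δ ^ 2 := by
      rw [lt_div_iff₀ (by positivity)] at hεδ
      rw [inv_mul_eq_div, le_div_iff₀ (by positivity)]
      linarith
    have h6 : 0 ≤ a * ‖z‖ := by positivity
    linarith [hlow z hz, le_abs_self (s + b)]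

variable [InnerProductSpace ℝ F]

/-- The Fenchel-Legendre transform of `regPotential D h ε`. -/
def regDual (D : Set F) (h : F → ℝ) (ε : ℝ) (y : F) : ℝ :=
  (⨆ z : D, (⟪(z : F), y⟫_ℝ - h z - ε / 2 * ‖(z : F)‖ ^ 2)) + ε / 2 * ‖y‖ ^ 2

lemma le_regDual (ha : 0 < a) (hlow : ∀ z ∈ D, a * ‖z‖ - b ≤ h z) (hε : 0 < ε)
    {z : F} (hz : z ∈ D) (y : F) :
    ⟪z, y⟫_ℝ - h z - ε / 2 * ‖z‖ ^ 2 + ε / 2 * ‖y‖ ^ 2 ≤ regDual D h ε y := by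
  refine add_le_add_left (le_ciSup (f := fun z : D =>
    ⟪(z : F), y⟫_ℝ - h z - ε / 2 * ‖(z : F)‖ ^ 2) ⟨b + (2 * ε)⁻¹ * ‖y‖ ^ 2, ?_⟩ ⟨z, hz⟩) _
  rintro _ ⟨w, rfl⟩
  have h1 := hlow w w.2
  have h2 : 0 ≤ a * ‖(w : F)‖ := by positivity
  have h3 := real_inner_le_norm (w : F) y
  have h4 : 0 ≤ (2 * ε)⁻¹ * (ε * ‖(w : F)‖ - ‖y‖) ^ 2 := by positivity
  have h5 : (2 * ε)⁻¹ * (ε * ‖(w : F)‖ - ‖y‖) ^ 2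
      = ε / 2 * ‖(w : F)‖ ^ 2 - ‖(w : F)‖ * ‖y‖ + (2 * ε)⁻¹ * ‖y‖ ^ 2 := by
    field_simp; ring
  beta_reduce
  linarith

lemma regDual_eq_fenchelR (ha : 0 < a) (hlow : ∀ z ∈ D, a * ‖z‖ - b ≤ h z) (hε : 0 < ε)
    (hD : D.Nonempty) (y : F) :
    (regDual D h ε y : EReal) = fenchelR (regPotential D h ε) y := by
  have := hD.to_subtype
  refine le_antisymm ?_ (iSup_le fun x => EReal.coe_le_coe_iff.2 ?_)
  · refine EReal.ge_of_forall_gt_iff_ge.1 fun s hs => ?_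
    rw [EReal.coe_lt_coe_iff, regDual, ← sub_lt_iff_lt_add] at hs
    obtain ⟨z, hz⟩ := exists_lt_of_lt_ciSup hs
    refine le_trans ?_ (le_iSup _ ((z : F) + ε • y))
    rw [EReal.coe_le_coe_iff]
    have h1 := regPotential_le ha hlow hε z.2 ((z : F) + ε • y)
    rw [add_sub_cancel_left, norm_smul, Real.norm_of_nonneg hε.le] at h1
    rw [inner_add_left, real_inner_smul_left, real_inner_self_eq_norm_sq]
    have h2 : (2 * ε)⁻¹ * (ε * ‖y‖) ^ 2 = ε / 2 * ‖y‖ ^ 2 := by field_simp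
    linarith
  · rw [sub_le_comm]
    refine le_regPotential hD fun z hz => ?_
    have h1 := le_regDual ha hlow hε hz y
    have h2 := real_inner_le_norm (x - z) y
    rw [inner_sub_left] at h2
    have h3 : 0 ≤ (2 * ε)⁻¹ * (ε * ‖y‖ - ‖x - z‖) ^ 2 := by positivity
    have h4 : (2 * ε)⁻¹ * (ε * ‖y‖ - ‖x - z‖) ^ 2
        = ε / 2 * ‖y‖ ^ 2 - ‖x - z‖ * ‖y‖ + (2 * ε)⁻¹ * ‖x - z‖ ^ 2 := by
      field_simp; ring
    linarith

lemma convexOn_regPotential (hh : ConvexOn ℝ D h) (ha : 0 < a)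
    (hlow : ∀ z ∈ D, a * ‖z‖ - b ≤ h z) (hε : 0 < ε) (hD : D.Nonempty) :
    ConvexOn ℝ univ (regPotential D h ε) := by
  have := hD.to_subtype
  have hsq : ConvexOn ℝ univ (fun x : F => ‖x‖ ^ 2) :=
    convexOn_univ_norm.pow (fun _ _ => norm_nonneg _) 2
  refine ⟨convex_univ, fun x _ y _ s t hs ht hst => le_of_forall_pos_le_add fun δ hδ => ?_⟩
  obtain ⟨z, hz⟩ := exists_lt_of_ciInf_lt (lt_add_of_pos_right (regPotential D h ε x) hδ)
  obtain ⟨w, hw⟩ := exists_lt_of_ciInf_lt (lt_add_of_pos_right (regPotential D h ε y) hδ)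
  have h1 := regPotential_le ha hlow hε (hh.1 z.2 w.2 hs ht hst) (s • x + t • y)
  have h2 := hh.2 z.2 w.2 hs ht hst
  have h3 := hsq.2 (mem_univ (z : F)) (mem_univ (w : F)) hs ht hst
  have h4 := hsq.2 (mem_univ (x - z : F)) (mem_univ (y - w : F)) hs ht hst
  have h5 : s • x + t • y - (s • (z : F) + t • (w : F)) = s • (x - z) + t • (y - w) := by module
  rw [h5] at h1
  simp only [smul_eq_mul] at h2 h3 h4 ⊢
  have h6 := mul_le_mul_of_nonneg_left h3 (by positivity : 0 ≤ ε / 2)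
  have h7 := mul_le_mul_of_nonneg_left h4 (by positivity : 0 ≤ (2 * ε)⁻¹)
  have h8 := mul_le_mul_of_nonneg_left hz.le hs
  have h9 := mul_le_mul_of_nonneg_left hw.le ht
  have h10 : s * δ + t * δ = δ := by rw [← add_mul, hst, one_mul]
  linarith

lemma linear_le_regDual (ha : 0 < a) (hlow : ∀ z ∈ D, a * ‖z‖ - b ≤ h z) (hε : 0 < ε)
    (hε1 : ε ≤ 1) {r M : ℝ} (hr : 0 < r) (hrD : Metric.ball 0 r ⊆ D)
    (hrM : ∀ x ∈ Metric.ball 0 r, h x ≤ M) (y : F) :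
    r / 2 * ‖y‖ - (M + r ^ 2 / 8) ≤ regDual D h ε y := by
  set z : F := (r / 2 * ‖y‖⁻¹) • y with hz
  have hzn : ‖z‖ ≤ r / 2 := by
    rw [hz, norm_smul, Real.norm_of_nonneg (by positivity), mul_assoc]
    have := inv_mul_le_one (a := ‖y‖)
    nlinarith
  have hzb : z ∈ Metric.ball (0 : F) r := by
    rw [mem_ball_zero_iff]; linarith
  have h1 := le_regDual ha hlow hε (hrD hzb) y
  have h2 := hrM z hzb
  have h3 : ⟪z, y⟫_ℝ = r / 2 * ‖y‖ := by
    rw [hz, real_inner_smul_left, real_inner_self_eq_norm_sq]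
    rcases eq_or_ne ‖y‖ 0 with h | h
    · simp [h]
    · field_simp
  have h4 : ε / 2 * ‖z‖ ^ 2 ≤ 1 / 2 * (r / 2) ^ 2 := by gcongr
  have h5 : 0 ≤ ε / 2 * ‖y‖ ^ 2 := by positivity
  rw [h3] at h1
  linarith

lemma eventually_le_regDual (ha : 0 < a) (hlow : ∀ z ∈ D, a * ‖z‖ - b ≤ h z)
    {y z : F} (hz : z ∈ D) {s : ℝ} (hs : s < ⟪z, y⟫_ℝ - h z) :
    ∀ᶠ ε in 𝓝[>] (0 : ℝ), s ≤ regDual D h ε y := by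
  have h1 : Tendsto (fun ε : ℝ => ⟪z, y⟫_ℝ - h z - ε / 2 * ‖z‖ ^ 2 + ε / 2 * ‖y‖ ^ 2) (𝓝[>] 0)
      (𝓝 (⟪z, y⟫_ℝ - h z)) := by
    refine Tendsto.mono_left ?_ nhdsWithin_le_nhds
    refine Continuous.tendsto' (by fun_prop) _ _ (by simp)
  filter_upwards [self_mem_nhdsWithin, h1.eventually_const_lt hs] with ε hε h2
  exact h2.le.trans (le_regDual ha hlow hε hz y)

lemma limsup_exp_neg_le_expNeg {t : EReal} (ht : t ≠ ⊥) {v : ℕ → ℝ}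
    (hv : ∀ s : ℝ, (s : EReal) < t → ∀ᶠ k in atTop, s ≤ v k) :
    limsup (fun k => ENNReal.ofReal (Real.exp (-v k))) atTop ≤ ENNReal.ofReal (expNeg t) := by
  have h1 : ∀ s : ℝ, (s : EReal) < t →
      limsup (fun k => ENNReal.ofReal (Real.exp (-v k))) atTop
        ≤ ENNReal.ofReal (Real.exp (-s)) := fun s hs =>
    limsup_le_of_le (by isBoundedDefault) ((hv s hs).mono fun k hk =>
      ENNReal.ofReal_le_ofReal (Real.exp_le_exp.2 (by linarith)))
  induction t with
  | bot => exact absurd rfl ht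
  | top =>
    have h2 : Tendsto (fun s : ℝ => ENNReal.ofReal (Real.exp (-s))) atTop
        (𝓝 (ENNReal.ofReal 0)) := ENNReal.tendsto_ofReal Real.tendsto_exp_neg_atTop_nhds_zero
    rw [show expNeg ⊤ = 0 by simp [expNeg]]
    exact ge_of_tendsto' h2 fun s => h1 s (EReal.coe_lt_top s)
  | coe r =>
    rw [expNeg_eq_exp (EReal.coe_ne_top r) ht, EReal.toReal_coe]
    have h2 : Tendsto (fun s : ℝ => ENNReal.ofReal (Real.exp (-s))) (𝓝[<] r)
        (𝓝 (ENNReal.ofReal (Real.exp (-r)))) := by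
      refine Tendsto.mono_left ?_ nhdsWithin_le_nhds
      exact (ENNReal.continuous_ofReal.comp
        (by fun_prop : Continuous fun s : ℝ => Real.exp (-s))).tendsto r
    exact ge_of_tendsto h2 (eventually_mem_nhdsWithin.mono fun s hs =>
      h1 s (EReal.coe_lt_coe_iff.2 hs))

lemma limsup_lintegral_exp_neg_le [FiniteDimensional ℝ F] [MeasurableSpace F] [BorelSpace F]
    (μ : Measure F) [μ.IsAddHaarMeasure] {f : F → EReal} (hbot : ∀ x, f x ≠ ⊥) {v : ℕ → F → ℝ}
    (hv : ∀ k, Continuous (v k)) (ha : 0 < a) (hlow : ∀ k x, a * ‖x‖ - b ≤ v k x)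
    (hlim : ∀ x, ∀ s : ℝ, (s : EReal) < f x → ∀ᶠ k in atTop, s ≤ v k x) :
    limsup (fun k => ∫⁻ x, ENNReal.ofReal (Real.exp (-v k x)) ∂μ) atTop
      ≤ ∫⁻ x, ENNReal.ofReal (expNeg (f x)) ∂μ := by
  have h1 : Integrable (fun x : F => Real.exp (-(a * ‖x‖ - b))) μ :=
    integrable_exp_neg_of_linear_le μ (by fun_prop) ha (fun _ => le_rfl)
  refine (limsup_lintegral_le (fun x => ENNReal.ofReal (Real.exp (-(a * ‖x‖ - b))))
    (fun k => ?_) (fun k => ae_of_all _ fun x => ?_) h1.lintegral_lt_top.ne).trans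
    (lintegral_mono fun x => limsup_exp_neg_le_expNeg (hbot x) (hlim x))
  · have := hv k
    exact Measurable.ennreal_ofReal (by fun_prop)
  · exact ENNReal.ofReal_le_ofReal (Real.exp_le_exp.2 (by linarith [hlow k x]))

lemma le_mul_of_limsup_le {u v : ℕ → ℝ≥0∞} {A B C : ℝ≥0∞} (hA : A ≠ ⊤) (hB : B ≠ ⊤)
    (hu : limsup u atTop ≤ A) (hv : limsup v atTop ≤ B) (h : ∀ k, C ≤ u k * v k) :
    C ≤ A * B := by
  have h1 : ∀ δ ∈ Ioi (0 : ℝ≥0∞), C ≤ (A + δ) * (B + δ) := by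
    intro δ hδ
    have h2 := eventually_lt_of_limsup_lt (hu.trans_lt (ENNReal.lt_add_right hA (ne_of_gt hδ)))
    have h3 := eventually_lt_of_limsup_lt (hv.trans_lt (ENNReal.lt_add_right hB (ne_of_gt hδ)))
    obtain ⟨k, hk1, hk2⟩ := (h2.and h3).exists
    exact (h k).trans (mul_le_mul' hk1.le hk2.le)
  have h4 : Tendsto (fun δ : ℝ≥0∞ => (A + δ) * (B + δ)) (𝓝[>] 0) (𝓝 (A * B)) := by
    have h5 : ∀ T : ℝ≥0∞, Tendsto (fun δ : ℝ≥0∞ => T + δ) (𝓝[>] 0) (𝓝 T) := fun T =>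
      Tendsto.mono_left (Continuous.tendsto' (by fun_prop) _ _ (by simp)) nhdsWithin_le_nhds
    exact ENNReal.Tendsto.mul (h5 A) (Or.inr hB) (h5 B) (Or.inr hA)
  exact ge_of_tendsto h4 (eventually_mem_nhdsWithin.mono h1)

end Regularization

/-- Corollary 2.4, transport-cost form. Fix `c > 0` and `n ≥ 1`.
If for every convex `V : ℝⁿ → ℝ` with everywhere finite Fenchel-Legendre transform `V*`
one has `H(η) + H(η*) ≤ -n log(c e²) + 𝒯(ν, ν*)` (with `η, η*` proportional to
`e^{-V}, e^{-V*}` and `ν, ν*` their moment measures), then for every proper convex lsc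
`f : ℝⁿ → ℝ ∪ {+∞}` with `∫ e^{-f} dx > 0` and `∫ e^{-f*} dx > 0` one has
`∫ e^{-f} dx ∫ e^{-f*} dx ≥ cⁿ`. -/
theorem statement3 {n : ℕ} (hn : 1 ≤ n) (c : ℝ) (hc : 0 < c)
    (hyp : ∀ V Vs : EuclideanSpace ℝ (Fin n) → ℝ, ConvexOn ℝ Set.univ V →
      (∀ y, (Vs y : EReal) = fenchelR V y) →
      ((relEnt (probOf V) + relEnt (probOf Vs) : ℝ) : EReal)
        ≤ ((-(n * Real.log (c * Real.exp 2)) : ℝ) : EReal)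
          + mcCost (Measure.map (gradient V) (probOf V))
              (Measure.map (gradient Vs) (probOf Vs))) :
    ∀ f : EuclideanSpace ℝ (Fin n) → EReal, IsProperConvexLSC f →
      0 < ∫⁻ x, ENNReal.ofReal (expNeg (f x)) →
      0 < ∫⁻ y, ENNReal.ofReal (expNeg (fenchel f y)) →
      ENNReal.ofReal (c ^ n)
        ≤ (∫⁻ x, ENNReal.ofReal (expNeg (f x))) * ∫⁻ y, ENNReal.ofReal (expNeg (fenchel f y)) := by
  intro f hf hpos hpos'
  by_cases hA : ∫⁻ x, ENNReal.ofReal (expNeg (f x)) = ⊤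
  · rw [hA, ENNReal.top_mul hpos'.ne']; exact le_top
  by_cases hB : ∫⁻ y, ENNReal.ofReal (expNeg (fenchel f y)) = ⊤
  · rw [hB, ENNReal.mul_top hpos.ne']; exact le_top
  have hfin : ∃ y, fenchel f y ≠ ⊤ := by
    by_contra! hcon
    exact measure_ne_top_set_ne_zero hpos' (by simp [hcon])
  obtain ⟨a, ha, b, hab⟩ := hf.exists_linear_le volume hpos hA hfin
  have ⟨hc', hlsc, hbot, x₀, hx₀⟩ := hf
  have hcv := hc'.convexOn_toReal hbot
  obtain ⟨r, hr, M, hrD, hrM⟩ := hcv.exists_ball_subset_le (hf.zero_mem_interior volume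
    (hcv.1.interior_nonempty_of_measure_ne_zero volume (measure_ne_top_set_ne_zero hpos))
    hpos' hB)
  set D := {x | f x ≠ ⊤} with hDdef
  set h := fun x => (f x).toReal with hh
  have hD : D.Nonempty := ⟨x₀, hx₀⟩
  set ε : ℕ → ℝ := fun k => 1 / ((k : ℝ) + 1) with hεdef
  have hε : ∀ k, 0 < ε k := fun k => by positivity
  have hε1 : ∀ k, ε k ≤ 1 := fun k => by
    rw [hεdef]; exact div_le_one_of_le₀ (by linarith [k.cast_nonneg (α := ℝ)]) (by positivity)
  have hεlim : Filter.Tendsto ε Filter.atTop (nhdsWithin 0 (Ioi 0)) :=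
    tendsto_nhdsWithin_iff.2
      ⟨tendsto_one_div_add_atTop_nhds_zero_nat, Filter.Eventually.of_forall hε⟩
  have hconv := fun k => convexOn_regPotential hcv ha hab (hε k) hD
  have hdual := fun k => regDual_eq_fenchelR ha hab (hε k) hD
  have hlow := fun k => linear_le_regPotential ha hab (hε k) (hε1 k) hD
  have hlow' := fun k => linear_le_regDual ha hab (hε k) (hε1 k) hr hrD hrM
  refine le_mul_of_limsup_le hA hB
    (limsup_lintegral_exp_neg_le volume hbot (fun k => (hconv k).locallyLipschitz.continuous)
      ha hlow fun x s hs => hεlim.eventually (eventually_le_regPotential ha hab hD ?_))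
    (limsup_lintegral_exp_neg_le volume (fenchel_ne_bot hx₀ (hbot x₀))
      (fun k => (convexOn_of_eq_fenchelR (hdual k)).locallyLipschitz.continuous)
      (half_pos hr) hlow' fun y s hs => ?_)
    (fun k => le_mul_lintegral_of_relEnt_le_mcCost hc (hconv k) (hdual k) ha (hlow k)
      (half_pos hr) (hlow' k) (hyp _ _ (hconv k) (hdual k)))
  · filter_upwards [hlsc x _ hs] with z hz hzD
    refine EReal.coe_le_coe_iff.1 ?_
    rw [EReal.coe_toReal hzD (hbot z)]
    exact hz.le
  · obtain ⟨z, hz⟩ := lt_iSup_iff.1 hs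
    have hzD : f z ≠ ⊤ := by
      intro htop
      simp [htop] at hz
    rw [← EReal.coe_toReal hzD (hbot z), ← EReal.coe_sub, EReal.coe_lt_coe_iff] at hz
    exact hεlim.eventually (eventually_le_regDual ha hab (z := z) hzD hz)

end
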